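/- arXiv:1609.07651 — 5 statements merged into one kernel-verified Lean document; each statement's English description precedes it below -/
import Mathlib

section
/- There exists a constant C > 0 such that for every k = (k₁,k₂,k₃) ∈ ℝ³ with k₁² + k₂² ≠ 0 and every μ ∈ {1,2,3}, the second polarization vector is partially differentiable at k and ‖∂_μ e(k,2)‖ ≤ C/√(k₁²+k₂²), where ‖·‖ is the Euclidean norm on ℝ³. -/
open RealInnerProductSpace EuclideanSpace

noncomputable section

/-- ℝ³ with the Euclidean norm. -/
abbrev R3 := EuclideanSpace ℝ (Fin 3)

/-- Build a vector of ℝ³ from its three components. -/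
def vec3 (a b c : ℝ) : R3 := (WithLp.equiv 2 (Fin 3 → ℝ)).symm ![a, b, c]

/-- X(k) = √(k₁² + k₂²). -/
def Xk (k : R3) : ℝ := Real.sqrt (k 0 ^ 2 + k 1 ^ 2)

/-- The cross product on ℝ³. -/
def cross3 (u v : R3) : R3 :=
  vec3 (u 1 * v 2 - u 2 * v 1) (u 2 * v 0 - u 0 * v 2) (u 0 * v 1 - u 1 * v 0)

/-- The first polarization vector e(k,1) = (k₂/X(k), −k₁/X(k), 0). -/
def polE1 (k : R3) : R3 := vec3 (k 1 / Xk k) (-(k 0) / Xk k) 0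

/-- The second polarization vector e(k,2) = (k/|k|) × e(k,1). -/
def polE2 (k : R3) : R3 := cross3 (‖k‖⁻¹ • k) (polE1 k)

/-- The polarization vectors e(k,j), j ∈ {1,2} (indexed by `Fin 2`). -/
def polE (j : Fin 2) (k : R3) : R3 := if j = 0 then polE1 k else polE2 k

/-- The normalization of a differentiable nonvanishing curve is differentiable, with derivative
bounded by `2 * ‖f'‖ / ‖f t‖`. -/
theorem exists_hasDerivAt_normalize {E : Type*} [NormedAddCommGroup E] [InnerProductSpace ℝ E]
    {f : ℝ → E} {f' : E} {t : ℝ} (hf : HasDerivAt f f' t) (h0 : f t ≠ 0) :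
    ∃ w : E, HasDerivAt (fun s => ‖f s‖⁻¹ • f s) w t ∧ ‖w‖ ≤ 2 * ‖f'‖ / ‖f t‖ := by
  have hpos : 0 < ‖f t‖ := norm_pos_iff.mpr h0
  have hnorm : HasDerivAt (fun s => ‖f s‖) (inner ℝ (f t) f' / ‖f t‖) t := by
    have h := hf.norm_sq.sqrt (pow_ne_zero 2 hpos.ne')
    simp only [Real.sqrt_sq (norm_nonneg _)] at h
    convert h using 1
    field_simp
  refine ⟨_, (hnorm.fun_inv hpos.ne').fun_smul hf, ?_⟩
  have hinner := abs_real_inner_le_norm (f t) f'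
  calc _ ≤ ‖‖f t‖⁻¹ • f'‖ + ‖(-(inner ℝ (f t) f' / ‖f t‖) / ‖f t‖ ^ 2) • f t‖ := norm_add_le _ _
    _ = ‖f'‖ / ‖f t‖ + |inner ℝ (f t) f'| / ‖f t‖ ^ 2 := by
      simp only [norm_smul, norm_inv, norm_div, norm_neg, norm_pow, Real.norm_eq_abs, abs_norm]
      field_simp
    _ ≤ ‖f'‖ / ‖f t‖ + ‖f t‖ * ‖f'‖ / ‖f t‖ ^ 2 := by gcongr
    _ = 2 * ‖f'‖ / ‖f t‖ := by field_simp; ring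

@[simp] theorem vec3_apply_zero (a b c : ℝ) : vec3 a b c 0 = a := rfl

@[simp] theorem vec3_apply_one (a b c : ℝ) : vec3 a b c 1 = b := rfl

@[simp] theorem vec3_apply_two (a b c : ℝ) : vec3 a b c 2 = c := rfl

theorem norm_vec3_zero (a b : ℝ) : ‖vec3 a b 0‖ = √(a ^ 2 + b ^ 2) := by
  simp [EuclideanSpace.norm_eq, Fin.sum_univ_three]

theorem norm_cross3_le (u v : R3) : ‖cross3 u v‖ ≤ ‖u‖ * ‖v‖ := by
  rw [← sq_le_sq₀ (norm_nonneg _) (by positivity), mul_pow]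
  simp only [EuclideanSpace.real_norm_sq_eq, Fin.sum_univ_three, cross3, vec3_apply_zero,
    vec3_apply_one, vec3_apply_two]
  nlinarith [sq_nonneg (u 0 * v 0 + u 1 * v 1 + u 2 * v 2)]

theorem hasDerivAt_vec3 {a b c : ℝ → ℝ} {a' b' c' t : ℝ} (ha : HasDerivAt a a' t)
    (hb : HasDerivAt b b' t) (hc : HasDerivAt c c' t) :
    HasDerivAt (fun s => vec3 (a s) (b s) (c s)) (vec3 a' b' c') t := by
  have h : HasDerivAt (fun s => ![a s, b s, c s]) ![a', b', c'] t := by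
    rw [hasDerivAt_pi]
    intro i
    fin_cases i <;> assumption
  exact ((PiLp.continuousLinearEquiv 2 ℝ (fun _ : Fin 3 => ℝ)).symm.hasFDerivAt).comp_hasDerivAt t h

theorem hasDerivAt_r3_apply {u : ℝ → R3} {u' : R3} {t : ℝ} (hu : HasDerivAt u u' t) (i : Fin 3) :
    HasDerivAt (fun s => u s i) (u' i) t :=
  (EuclideanSpace.proj (𝕜 := ℝ) i).hasFDerivAt.comp_hasDerivAt t hu

theorem hasDerivAt_cross3 {u v : ℝ → R3} {u' v' : R3} {t : ℝ} (hu : HasDerivAt u u' t)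
    (hv : HasDerivAt v v' t) :
    HasDerivAt (fun s => cross3 (u s) (v s)) (cross3 u' (v t) + cross3 (u t) v') t := by
  have key (i j : Fin 3) := ((hasDerivAt_r3_apply hu i).fun_mul (hasDerivAt_r3_apply hv j)).fun_sub
    ((hasDerivAt_r3_apply hu j).fun_mul (hasDerivAt_r3_apply hv i))
  refine (hasDerivAt_vec3 (key 1 2) (key 2 0) (key 0 1)).congr_deriv ?_
  ext i
  fin_cases i <;> simp [cross3] <;> ring

theorem polE1_eq_normalize (k : R3) :
    polE1 k = ‖vec3 (k 1) (-k 0) 0‖⁻¹ • vec3 (k 1) (-k 0) 0 := by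
  rw [norm_vec3_zero, neg_sq, add_comm]
  ext i
  fin_cases i <;> simp [polE1, Xk, div_eq_inv_mul]

theorem norm_inv_norm_smul_le_one {E : Type*} [NormedAddCommGroup E] [NormedSpace ℝ E] (x : E) :
    ‖‖x‖⁻¹ • x‖ ≤ 1 := by
  rw [norm_smul, norm_inv, norm_norm]
  exact inv_mul_le_one

theorem exists_hasLineDerivAt_polE2 {k : R3} (hk : k 0 ^ 2 + k 1 ^ 2 ≠ 0) (e : R3) :
    ∃ w : R3, HasLineDerivAt ℝ polE2 w k e ∧ ‖w‖ ≤ 4 * ‖e‖ / √(k 0 ^ 2 + k 1 ^ 2) := by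
  set X := √(k 0 ^ 2 + k 1 ^ 2)
  have hXpos : 0 < X := Real.sqrt_pos.mpr (lt_of_le_of_ne (by positivity) hk.symm)
  have hXk : X ≤ ‖k‖ := by
    rw [EuclideanSpace.norm_eq]
    refine Real.sqrt_le_sqrt ?_
    simp only [Fin.sum_univ_three, Real.norm_eq_abs, sq_abs]
    linarith [sq_nonneg (k 2)]
  have hline : HasDerivAt (fun t : ℝ => k + t • e) e 0 := by
    simpa using ((hasDerivAt_id (0 : ℝ)).smul_const e).const_add k
  have hrot : HasDerivAt (fun t : ℝ => vec3 ((k + t • e) 1) (-(k + t • e) 0) 0)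
      (vec3 (e 1) (-e 0) 0) 0 :=
    hasDerivAt_vec3 (hasDerivAt_r3_apply hline 1) (hasDerivAt_r3_apply hline 0).fun_neg
      (hasDerivAt_const 0 0)
  have hrot_norm : ‖vec3 (k 1) (-k 0) 0‖ = X := by rw [norm_vec3_zero, neg_sq, add_comm]
  have hrot_le : ‖vec3 (e 1) (-e 0) 0‖ ≤ ‖e‖ := by
    rw [norm_vec3_zero, EuclideanSpace.norm_eq]
    refine Real.sqrt_le_sqrt ?_
    simp only [Fin.sum_univ_three, Real.norm_eq_abs, sq_abs]
    linarith [sq_nonneg (e 2)]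
  obtain ⟨u', hu, hu_le⟩ := exists_hasDerivAt_normalize hline
    (by simpa using norm_pos_iff.mp (hXpos.trans_le hXk))
  obtain ⟨v', hv, hv_le⟩ := exists_hasDerivAt_normalize hrot
    (by simpa using norm_pos_iff.mp (hrot_norm ▸ hXpos))
  simp only [← polE1_eq_normalize] at hv
  simp only [zero_smul, add_zero, hrot_norm] at hu_le hv_le
  refine ⟨_, hasDerivAt_cross3 hu hv, ?_⟩
  simp only [zero_smul, add_zero]
  have hpol : ‖polE1 k‖ ≤ 1 := by
    rw [polE1_eq_normalize]
    exact norm_inv_norm_smul_le_one _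
  calc _ ≤ ‖u'‖ * ‖polE1 k‖ + ‖‖k‖⁻¹ • k‖ * ‖v'‖ :=
        (norm_add_le _ _).trans (add_le_add (norm_cross3_le _ _) (norm_cross3_le _ _))
    _ ≤ 2 * ‖e‖ / ‖k‖ * 1 + 1 * (2 * ‖vec3 (e 1) (-e 0) 0‖ / X) := by
        gcongr
        exact norm_inv_norm_smul_le_one k
    _ ≤ 2 * ‖e‖ / X * 1 + 1 * (2 * ‖e‖ / X) := by gcongr
    _ = 4 * ‖e‖ / X := by ring

/-- There exists a constant C > 0 such that for every k ∈ ℝ³ with k₁² + k₂² ≠ 0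
and every μ ∈ {1,2,3}, e(·,2) is partially differentiable at k in the μ-th direction and
‖∂_μ e(k,2)‖ ≤ C/√(k₁²+k₂²). -/
theorem polE2_deriv_bound :
    ∃ C > (0 : ℝ), ∀ k : R3, k 0 ^ 2 + k 1 ^ 2 ≠ 0 → ∀ μ : Fin 3,
      LineDifferentiableAt ℝ polE2 k (EuclideanSpace.single μ (1 : ℝ)) ∧
      ‖lineDeriv ℝ polE2 k (EuclideanSpace.single μ (1 : ℝ))‖ ≤
        C / Real.sqrt (k 0 ^ 2 + k 1 ^ 2) := by
  refine ⟨4, by norm_num, fun k hk μ => ?_⟩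
  obtain ⟨w, hw, hw_le⟩ := exists_hasLineDerivAt_polE2 hk (EuclideanSpace.single μ (1 : ℝ))
  refine ⟨hw.lineDifferentiableAt, ?_⟩
  rw [hw.lineDeriv]
  simpa using hw_le
end
end

section
/- There exists a constant C > 0 such that for j ∈ {1,2}, every k = (k₁,k₂,k₃) ∈ ℝ³ with k₁² + k₂² ≠ 0 and every μ ∈ {1,2,3}, the polarization vector e(·,j) is twice partially differentiable in the μ-th direction at k and the second partial derivative satisfies ‖∂_μ∂_μ e(k,j)‖ ≤ C/(k₁²+k₂²), where ‖·‖ is the Euclidean norm on ℝ³. -/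
open RealInnerProductSpace EuclideanSpace

noncomputable section

section

variable {F : Type*} [NormedAddCommGroup F] [NormedSpace ℝ F]

/-- Along `v`, the function `f` is bounded and twice differentiable off the axis `X(k) = 0`,
with `m`-th derivative bounded by a multiple of `X(k)⁻ᵐ` for `m ≤ 2`. -/
def HasSecondOrderBound (v : R3) (f : R3 → F) : Prop :=
  ∃ (f' f'' : R3 → F) (C : ℝ), ∀ k, Xk k ≠ 0 →
    HasLineDerivAt ℝ f (f' k) k v ∧ HasLineDerivAt ℝ f' (f'' k) k v ∧
      ‖f k‖ ≤ C ∧ ‖f' k‖ ≤ C / Xk k ∧ ‖f'' k‖ ≤ C / Xk k ^ 2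

theorem Xk_nonneg (k : R3) : 0 ≤ Xk k := Real.sqrt_nonneg _

theorem Xk_sq (k : R3) : Xk k ^ 2 = k 0 ^ 2 + k 1 ^ 2 := Real.sq_sqrt (by positivity)

theorem continuous_Xk : Continuous Xk := by
  unfold Xk
  fun_prop

theorem HasSecondOrderBound.const (v : R3) (c : F) : HasSecondOrderBound v fun _ => c := by
  refine ⟨0, 0, ‖c‖, fun k _ => ⟨hasDerivAt_const _ _, hasDerivAt_const _ _, le_rfl, ?_, ?_⟩⟩ <;>
  · have := Xk_nonneg k
    simp only [Pi.zero_apply, norm_zero]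
    positivity

theorem HasSecondOrderBound.add {v : R3} {f g : R3 → F} (hf : HasSecondOrderBound v f)
    (hg : HasSecondOrderBound v g) : HasSecondOrderBound v fun k => f k + g k := by
  obtain ⟨f', f'', A, hf⟩ := hf
  obtain ⟨g', g'', B, hg⟩ := hg
  refine ⟨fun k => f' k + g' k, fun k => f'' k + g'' k, A + B, fun k hk => ?_⟩
  obtain ⟨hf1, hf2, bf0, bf1, bf2⟩ := hf k hk
  obtain ⟨hg1, hg2, bg0, bg1, bg2⟩ := hg k hk
  refine ⟨HasDerivAt.add hf1 hg1, HasDerivAt.add hf2 hg2, norm_add_le_of_le bf0 bg0, ?_, ?_⟩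
  · rw [add_div]
    exact norm_add_le_of_le bf1 bg1
  · rw [add_div]
    exact norm_add_le_of_le bf2 bg2

theorem HasLineDerivAt.smul_fun {v k : R3} {f : R3 → ℝ} {g : R3 → F} {f' : ℝ} {g' : F}
    (hf : HasLineDerivAt ℝ f f' k v) (hg : HasLineDerivAt ℝ g g' k v) :
    HasLineDerivAt ℝ (fun k => f k • g k) (f k • g' + f' • g k) k v := by
  have h := HasDerivAt.smul hf hg
  simp only [zero_smul, add_zero] at h
  exact h

theorem HasSecondOrderBound.smul {v : R3} {f : R3 → ℝ} {g : R3 → F}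
    (hf : HasSecondOrderBound v f) (hg : HasSecondOrderBound v g) :
    HasSecondOrderBound v fun k => f k • g k := by
  obtain ⟨f', f'', A, hf⟩ := hf
  obtain ⟨g', g'', B, hg⟩ := hg
  refine ⟨fun k => f k • g' k + f' k • g k,
    fun k => (f k • g'' k + f' k • g' k) + (f' k • g' k + f'' k • g k), 4 * (A * B),
    fun k hk => ?_⟩
  obtain ⟨hf1, hf2, bf0, bf1, bf2⟩ := hf k hk
  obtain ⟨hg1, hg2, bg0, bg1, bg2⟩ := hg k hk
  have hX := Xk_nonneg k
  have hA : 0 ≤ A := (norm_nonneg _).trans bf0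
  have hB : 0 ≤ B := (norm_nonneg _).trans bg0
  have hAB : 0 ≤ A * B := mul_nonneg hA hB
  have bound {x : ℝ} {y : F} {a b : ℝ} (hx : ‖x‖ ≤ a) (hy : ‖y‖ ≤ b) : ‖x • y‖ ≤ a * b := by
    rw [norm_smul]
    exact mul_le_mul hx hy (norm_nonneg _) ((norm_nonneg _).trans hx)
  refine ⟨hf1.smul_fun hg1, HasDerivAt.add (hf1.smul_fun hg2) (hf2.smul_fun hg1), ?_, ?_, ?_⟩
  · linarith [bound bf0 bg0]
  · refine (norm_add_le_of_le (bound bf0 bg1) (bound bf1 bg0)).trans ?_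
    calc A * (B / Xk k) + A / Xk k * B = 2 * (A * B) / Xk k := by ring
      _ ≤ _ := by gcongr; norm_num
  · refine (norm_add_le_of_le (norm_add_le_of_le (bound bf0 bg2) (bound bf1 bg1))
      (norm_add_le_of_le (bound bf1 bg1) (bound bf2 bg0))).trans (le_of_eq ?_)
    ring

theorem HasSecondOrderBound.neg {v : R3} {f : R3 → F} (hf : HasSecondOrderBound v f) :
    HasSecondOrderBound v fun k => -f k := by
  simpa using (HasSecondOrderBound.const v (-1 : ℝ)).smul hf

theorem HasSecondOrderBound.vec3 {v : R3} {a b c : R3 → ℝ} (ha : HasSecondOrderBound v a)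
    (hb : HasSecondOrderBound v b) (hc : HasSecondOrderBound v c) :
    HasSecondOrderBound v fun k => vec3 (a k) (b k) (c k) := by
  convert ((ha.smul (.const v (EuclideanSpace.single 0 1 : R3))).add
    (hb.smul (.const v (EuclideanSpace.single 1 1 : R3)))).add
    (hc.smul (.const v (EuclideanSpace.single 2 1 : R3))) using 2 with k
  ext i
  fin_cases i <;> simp [_root_.vec3]

/-- The components of `L k / ‖L k‖` satisfy the second order bound. -/
theorem hasSecondOrderBound_normalized (L : R3 →L[ℝ] R3) {v : R3} (hv : ‖L v‖ ≤ 1)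
    (hL : ∀ k, Xk k ≤ ‖L k‖) (i : Fin 3) :
    HasSecondOrderBound v fun k => L k i / ‖L k‖ := by
  refine ⟨fun k => L v i / ‖L k‖ - L k i * ⟪L k, L v⟫ / ‖L k‖ ^ 3,
    fun k => -2 * (L v i * ⟪L k, L v⟫) / ‖L k‖ ^ 3 - L k i * ‖L v‖ ^ 2 / ‖L k‖ ^ 3
      + 3 * (L k i * ⟪L k, L v⟫ ^ 2) / ‖L k‖ ^ 5, 6, fun k hk => ?_⟩
  have hX : 0 < Xk k := (Xk_nonneg k).lt_of_ne' hk
  have hr : 0 < ‖L k‖ := hX.trans_le (hL k)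
  have hline : HasDerivAt (fun t : ℝ => L (k + t • v)) (L v) 0 := by
    have := ((hasDerivAt_id (0 : ℝ)).smul_const (L v)).const_add (L k)
    simpa using this
  have hcoord : HasDerivAt (fun t : ℝ => L (k + t • v) i) (L v i) 0 :=
    (EuclideanSpace.proj i : R3 →L[ℝ] ℝ).hasFDerivAt.comp_hasDerivAt (0 : ℝ) hline
  have hinner : HasDerivAt (fun t : ℝ => ⟪L (k + t • v), L v⟫) (‖L v‖ ^ 2) 0 := by
    simpa using hline.inner ℝ (hasDerivAt_const (0 : ℝ) (L v))
  have hnorm : HasDerivAt (fun t : ℝ => ‖L (k + t • v)‖) (⟪L k, L v⟫ / ‖L k‖) 0 := by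
    have h := hline.norm_sq.sqrt (by simpa using hr.ne')
    simp only [zero_smul, add_zero, Real.sqrt_sq (norm_nonneg _)] at h
    convert h using 1
    field_simp
  have h0 : ‖L (k + (0 : ℝ) • v)‖ ≠ 0 := by simpa using hr.ne'
  have bi (w : R3) : |w i| ≤ ‖w‖ := PiLp.norm_apply_le w i
  have bs : |⟪L k, L v⟫| ≤ ‖L k‖ := (abs_real_inner_le_norm _ _).trans
    (mul_le_of_le_one_right (norm_nonneg _) hv)
  have bk := bi (L k)
  have bv := (bi (L v)).trans hv
  refine ⟨?_, ?_, ?_, ?_, ?_⟩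
  · refine HasDerivAt.congr_deriv (hcoord.div hnorm h0) ?_
    simp only [zero_smul, add_zero]
    field_simp
  · refine HasDerivAt.congr_deriv (((hasDerivAt_const (0 : ℝ) (L v i)).div hnorm h0).sub
      ((hcoord.mul hinner).div (hnorm.pow 3) (pow_ne_zero 3 h0))) ?_
    simp only [zero_smul, add_zero, Pi.mul_apply, Nat.cast_ofNat]
    field_simp
    ring
  · rw [norm_div, norm_norm, Real.norm_eq_abs, div_le_iff₀ hr]
    linarith
  · calc _ ≤ 1 / ‖L k‖ + ‖L k‖ * ‖L k‖ / ‖L k‖ ^ 3 := by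
          refine (norm_sub_le _ _).trans ?_
          simp only [norm_div, norm_mul, norm_pow, Real.norm_eq_abs, abs_norm]
          gcongr
      _ = 2 / ‖L k‖ := by field_simp; norm_num
      _ ≤ _ := by gcongr; norm_num; exact hL k
  · calc _ ≤ 2 * (1 * ‖L k‖) / ‖L k‖ ^ 3 + ‖L k‖ * 1 ^ 2 / ‖L k‖ ^ 3
          + 3 * (‖L k‖ * ‖L k‖ ^ 2) / ‖L k‖ ^ 5 := by
          refine norm_add_le_of_le ((norm_sub_le _ _).trans ?_) ?_
          all_goals
            simp only [norm_div, norm_mul, norm_pow, norm_neg, Real.norm_eq_abs,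
              abs_norm, Nat.abs_ofNat]
            gcongr
      _ = 6 / ‖L k‖ ^ 2 := by field_simp; norm_num
      _ ≤ _ := by gcongr; exact hL k

/-- A second order bound controls the iterated `lineDeriv`. -/
theorem HasSecondOrderBound.exists_lineDeriv_bound {v : R3} {f : R3 → F}
    (hf : HasSecondOrderBound v f) :
    ∃ C : ℝ, ∀ k, Xk k ≠ 0 → LineDifferentiableAt ℝ f k v ∧
      LineDifferentiableAt ℝ (fun y => lineDeriv ℝ f y v) k v ∧
      ‖lineDeriv ℝ (fun y => lineDeriv ℝ f y v) k v‖ ≤ C / Xk k ^ 2 := by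
  obtain ⟨f', f'', C, hf⟩ := hf
  refine ⟨C, fun k hk => ?_⟩
  obtain ⟨h1, h2, -, -, hC⟩ := hf k hk
  have hcont : ContinuousAt (fun t : ℝ => Xk (k + t • v)) 0 :=
    (continuous_Xk.comp (by fun_prop)).continuousAt
  have hev := hcont.eventually_ne (y := 0) (by simpa using hk)
  have h : HasLineDerivAt ℝ (fun y => lineDeriv ℝ f y v) (f'' k) k v :=
    HasDerivAt.congr_of_eventuallyEq h2 (hev.mono fun t ht => (hf _ ht).1.lineDeriv)
  exact ⟨h1.lineDifferentiableAt, h.lineDifferentiableAt, h.lineDeriv.symm ▸ hC⟩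

end

/-- The orthogonal projection of ℝ³ onto the plane of the first two coordinates. -/
def planeProj : R3 →L[ℝ] R3 :=
  LinearMap.toContinuousLinearMap
    { toFun := fun k => vec3 (k 0) (k 1) 0
      map_add' := fun x y => by ext i; fin_cases i <;> simp [vec3]
      map_smul' := fun c x => by ext i; fin_cases i <;> simp [vec3] }

theorem planeProj_apply (k : R3) : planeProj k = vec3 (k 0) (k 1) 0 := rfl

theorem norm_planeProj (k : R3) : ‖planeProj k‖ = Xk k := by
  simp [planeProj_apply, EuclideanSpace.norm_eq, Fin.sum_univ_three, vec3, Xk]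

theorem Xk_le_norm (k : R3) : Xk k ≤ ‖k‖ := by
  rw [EuclideanSpace.norm_eq, Fin.sum_univ_three, Xk]
  refine Real.sqrt_le_sqrt ?_
  simp only [Real.norm_eq_abs, sq_abs]
  linarith [sq_nonneg (k 2)]

theorem hasSecondOrderBound_polE (j : Fin 2) {v : R3} (hv : ‖v‖ ≤ 1) :
    HasSecondOrderBound v (polE j) := by
  have hp := hasSecondOrderBound_normalized planeProj
    ((norm_planeProj v).trans_le ((Xk_le_norm v).trans hv)) (fun k => (norm_planeProj k).ge)
  simp only [norm_planeProj] at hp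
  simp only [planeProj_apply] at hp
  have hu := hasSecondOrderBound_normalized (.id ℝ R3) hv Xk_le_norm
  have ha := hp 1
  have hb := (hp 0).neg
  have hz := HasSecondOrderBound.const v (0 : ℝ)
  fin_cases j
  · convert ha.vec3 hb hz using 2 with k
    simp [polE, polE1, vec3, neg_div]
  · convert ((hu 2).smul hb).neg.vec3 ((hu 2).smul ha)
      (((hu 0).smul hb).add ((hu 1).smul ha).neg) using 2 with k
    simp [polE, polE2, cross3, polE1, vec3, neg_div]
    ring_nf
    simp

/-- There exists a constant C > 0 such that for j ∈ {1,2}, every k ∈ ℝ³ with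
k₁² + k₂² ≠ 0 and every μ ∈ {1,2,3}, the polarization vector e(·,j) is twice partially
differentiable in the μ-th direction at k and ‖∂_μ∂_μ e(k,j)‖ ≤ C/(k₁²+k₂²). -/
theorem polE_second_deriv_bound :
    ∃ C > (0 : ℝ), ∀ j : Fin 2, ∀ k : R3, k 0 ^ 2 + k 1 ^ 2 ≠ 0 → ∀ μ : Fin 3,
      LineDifferentiableAt ℝ (polE j) k (EuclideanSpace.single μ (1 : ℝ)) ∧
      LineDifferentiableAt ℝ
        (fun y => lineDeriv ℝ (polE j) y (EuclideanSpace.single μ (1 : ℝ))) k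
        (EuclideanSpace.single μ (1 : ℝ)) ∧
      ‖lineDeriv ℝ
          (fun y => lineDeriv ℝ (polE j) y (EuclideanSpace.single μ (1 : ℝ))) k
          (EuclideanSpace.single μ (1 : ℝ))‖ ≤ C / (k 0 ^ 2 + k 1 ^ 2) := by
  choose C hC using fun (j : Fin 2) (μ : Fin 3) => (hasSecondOrderBound_polE j
    (v := EuclideanSpace.single μ (1 : ℝ)) (by simp)).exists_lineDeriv_bound
  refine ⟨∑ p : Fin 2 × Fin 3, |C p.1 p.2| + 1, by positivity, fun j k hk μ => ?_⟩
  rw [← Xk_sq] at hk ⊢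
  obtain ⟨h1, h2, h3⟩ := hC j μ k (by simpa using hk)
  refine ⟨h1, h2, h3.trans ?_⟩
  gcongr
  have := Finset.single_le_sum (f := fun p : Fin 2 × Fin 3 => |C p.1 p.2|)
    (fun p _ => abs_nonneg _) (Finset.mem_univ (j, μ))
  linarith [le_abs_self (C j μ)]
end
end

section
/- There exists a constant C > 0 such that for j ∈ {1,2}, for every k = (k₁,k₂,k₃) ∈ ℝ³ with k_μ ≠ 0 for all μ ∈ {1,2,3}, and for every h = (h₁,h₂,h₃) ∈ ℝ³ satisfying 2|h_μ| ≤ |k_μ| for μ = 1,2,3, one has ‖e(k+h,j) − e(k,j)‖ ≤ C|h|/√(k₁²+k₂²), where ‖·‖ and |h| denote the Euclidean norm on ℝ³. -/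
open RealInnerProductSpace EuclideanSpace

noncomputable section

/-- Normalization to the unit sphere is Lipschitz away from the origin. -/
theorem norm_inv_smul_sub_inv_smul_le {E : Type*} [NormedAddCommGroup E] [NormedSpace ℝ E]
    (u v : E) (hv : v ≠ 0) :
    ‖‖u‖⁻¹ • u - ‖v‖⁻¹ • v‖ ≤ 2 * ‖u - v‖ / ‖v‖ := by
  have hv' : 0 < ‖v‖ := norm_pos_iff.mpr hv
  have hunit : ‖‖u‖⁻¹ • u‖ ≤ 1 := by
    rw [norm_smul, norm_inv, norm_norm]
    exact inv_mul_le_one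
  have hu : ‖u‖ • ‖u‖⁻¹ • u = u := by
    rcases eq_or_ne u 0 with rfl | h
    · simp
    · rw [smul_inv_smul₀ (norm_ne_zero_iff.mpr h)]
  have hdecomp : ‖v‖ • (‖u‖⁻¹ • u - ‖v‖⁻¹ • v) =
      (‖v‖ - ‖u‖) • (‖u‖⁻¹ • u) + (u - v) := by
    rw [smul_sub, sub_smul, hu, smul_inv_smul₀ hv'.ne']
    abel
  rw [le_div_iff₀ hv']
  calc ‖‖u‖⁻¹ • u - ‖v‖⁻¹ • v‖ * ‖v‖
      = ‖‖v‖ • (‖u‖⁻¹ • u - ‖v‖⁻¹ • v)‖ := by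
        rw [norm_smul, norm_norm, mul_comm]
    _ ≤ |‖v‖ - ‖u‖| * ‖‖u‖⁻¹ • u‖ + ‖u - v‖ := by
        rw [hdecomp]
        refine (norm_add_le _ _).trans_eq ?_
        rw [norm_smul, Real.norm_eq_abs]
    _ ≤ ‖u - v‖ * 1 + ‖u - v‖ := by
        gcongr
        rw [norm_sub_rev]
        exact abs_norm_sub_norm_le v u
    _ = 2 * ‖u - v‖ := by ring

theorem norm_vec3 (a b c : ℝ) : ‖vec3 a b c‖ = √(a ^ 2 + b ^ 2 + c ^ 2) := by
  simp [EuclideanSpace.norm_eq, vec3, Fin.sum_univ_three]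

theorem norm_sq_R3 (u : R3) : ‖u‖ ^ 2 = u 0 ^ 2 + u 1 ^ 2 + u 2 ^ 2 := by
  simp [EuclideanSpace.norm_sq_eq, Fin.sum_univ_three]

theorem cross3_sub_cross3 (u u' v v' : R3) :
    cross3 u' v' - cross3 u v = cross3 (u' - u) v' + cross3 u (v' - v) := by
  ext i
  fin_cases i <;> simp [cross3, vec3] <;> ring

theorem norm_vec3_rotated (k : R3) : ‖vec3 (k 1) (-(k 0)) 0‖ = Xk k := by
  rw [norm_vec3, Xk]
  congr 1
  ring

theorem polE1_eq_inv_norm_smul (k : R3) :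
    polE1 k = ‖vec3 (k 1) (-(k 0)) 0‖⁻¹ • vec3 (k 1) (-(k 0)) 0 := by
  rw [norm_vec3_rotated]
  ext i
  fin_cases i <;> simp [polE1, vec3, div_eq_inv_mul]

theorem norm_polE1_le_one (k : R3) : ‖polE1 k‖ ≤ 1 := by
  rw [polE1_eq_inv_norm_smul, norm_smul, norm_inv, norm_norm]
  exact inv_mul_le_one

theorem norm_polE1_add_sub_le (k h : R3) (hk : 0 < Xk k) :
    ‖polE1 (k + h) - polE1 k‖ ≤ 2 * ‖h‖ / Xk k := by
  have hw : vec3 (k 1) (-(k 0)) 0 ≠ 0 := by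
    rwa [← norm_pos_iff, norm_vec3_rotated]
  have hdiff : vec3 ((k + h) 1) (-((k + h) 0)) 0 - vec3 (k 1) (-(k 0)) 0 =
      vec3 (h 1) (-(h 0)) 0 := by
    ext i
    fin_cases i <;> simp [vec3]
  rw [polE1_eq_inv_norm_smul, polE1_eq_inv_norm_smul]
  refine (norm_inv_smul_sub_inv_smul_le _ _ hw).trans ?_
  rw [hdiff, norm_vec3_rotated, norm_vec3_rotated]
  gcongr
  exact Xk_le_norm h

theorem norm_polE2_add_sub_le (k h : R3) (hk : 0 < Xk k) :
    ‖polE2 (k + h) - polE2 k‖ ≤ 4 * ‖h‖ / Xk k := by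
  have hk0 : k ≠ 0 := norm_pos_iff.mp (hk.trans_le (Xk_le_norm k))
  have hdir : ‖‖k + h‖⁻¹ • (k + h) - ‖k‖⁻¹ • k‖ ≤ 2 * ‖h‖ / Xk k := by
    refine (norm_inv_smul_sub_inv_smul_le (k + h) k hk0).trans ?_
    rw [add_sub_cancel_left]
    gcongr
    exact Xk_le_norm k
  have hunit : ‖‖k‖⁻¹ • k‖ ≤ 1 := by
    rw [norm_smul, norm_inv, norm_norm]
    exact inv_mul_le_one
  rw [polE2, polE2, cross3_sub_cross3]
  calc _ ≤ _ := norm_add_le _ _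
    _ ≤ _ := add_le_add (norm_cross3_le _ _) (norm_cross3_le _ _)
    _ ≤ 2 * ‖h‖ / Xk k * 1 + 1 * (2 * ‖h‖ / Xk k) := by
        gcongr
        · exact norm_polE1_le_one _
        · exact norm_polE1_add_sub_le k h hk
    _ = 4 * ‖h‖ / Xk k := by ring

/-- There exists a constant C > 0 such that for j ∈ {1,2}, every k ∈ ℝ³ with all
components nonzero, and every h ∈ ℝ³ with 2|h_μ| ≤ |k_μ| for μ = 1,2,3, one has
‖e(k+h,j) − e(k,j)‖ ≤ C|h|/√(k₁²+k₂²). -/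
theorem polE_increment_bound :
    ∃ C > (0 : ℝ), ∀ j : Fin 2, ∀ k : R3, (∀ μ : Fin 3, k μ ≠ 0) →
      ∀ h : R3, (∀ μ : Fin 3, 2 * |h μ| ≤ |k μ|) →
        ‖polE j (k + h) - polE j k‖ ≤ C * ‖h‖ / Real.sqrt (k 0 ^ 2 + k 1 ^ 2) := by
  refine ⟨4, by norm_num, fun j k hk h _ => ?_⟩
  have hX : 0 < Xk k := by
    have := hk 0
    unfold Xk
    positivity
  change _ ≤ 4 * ‖h‖ / Xk k
  unfold polE
  split_ifs
  · refine (norm_polE1_add_sub_le k h hX).trans ?_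
    gcongr
    norm_num
  · exact norm_polE2_add_sub_le k h hX
end
end

section
/- Let φ̂ : ℝ³ → ℝ be continuously differentiable with ‖φ̂‖_∞ := sup_k |φ̂(k)| < ∞ and ‖∇φ̂‖_∞ := sup_k ‖∇φ̂(k)‖ < ∞. Then there is a constant C > 0, depending only on ‖φ̂‖_∞ and ‖∇φ̂‖_∞ (in particular independent of m), such that for every m > 0, every k ∈ ℝ³ with k_μ ≠ 0 for all μ ∈ {1,2,3}, and every h ∈ ℝ³ with 2|h_μ| ≤ |k_μ| for μ = 1,2,3, one has | φ̂(k+h)/√(ω_m(k+h)) − φ̂(k)/√(ω_m(k)) | ≤ C·|h|·( ω_m(k)^{−1/2} + ω_m(k)^{−3/2} ). -/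
noncomputable section

/-- The dispersion relation ω_m(k) = √(|k|² + m²). -/
def disp (m : ℝ) (k : R3) : ℝ := Real.sqrt (‖k‖ ^ 2 + m ^ 2)

theorem disp_pos {m : ℝ} (hm : 0 < m) (k : R3) : 0 < disp m k := by
  unfold disp
  positivity

theorem norm_le_disp (m : ℝ) (k : R3) : ‖k‖ ≤ disp m k :=
  Real.le_sqrt_of_sq_le (by nlinarith [sq_nonneg m])

theorem disp_sq (m : ℝ) (k : R3) : disp m k ^ 2 = ‖k‖ ^ 2 + m ^ 2 :=
  Real.sq_sqrt (by positivity)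

/-- The dispersion relation is 1-Lipschitz. -/
theorem abs_disp_add_sub_le {m : ℝ} (hm : 0 < m) (k h : R3) :
    |disp m (k + h) - disp m k| ≤ ‖h‖ := by
  have ha := disp_pos hm k
  have hb := disp_pos hm (k + h)
  have hk := norm_le_disp m k
  have hkh := norm_le_disp m (k + h)
  have hnorm : |‖k + h‖ - ‖k‖| ≤ ‖h‖ := by
    simpa using abs_norm_sub_norm_le (k + h) k
  have hfactor : (disp m (k + h) - disp m k) * (disp m (k + h) + disp m k) =
      (‖k + h‖ - ‖k‖) * (‖k + h‖ + ‖k‖) := by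
    linear_combination disp_sq m (k + h) - disp_sq m k
  have habs := congrArg abs hfactor
  rw [abs_mul, abs_mul, abs_of_pos (add_pos hb ha),
    abs_of_nonneg (add_nonneg (norm_nonneg (k + h)) (norm_nonneg k))] at habs
  refine le_of_mul_le_mul_right ?_ (add_pos hb ha)
  rw [habs]
  gcongr

theorem two_mul_norm_le_of_coord {k h : R3} (hh : ∀ μ : Fin 3, 2 * |h μ| ≤ |k μ|) :
    2 * ‖h‖ ≤ ‖k‖ := by
  refine (abs_le_of_sq_le_sq' ?_ (norm_nonneg k)).2
  rw [mul_pow, EuclideanSpace.norm_sq_eq, EuclideanSpace.norm_sq_eq, Finset.mul_sum]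
  refine Finset.sum_le_sum fun μ _ => ?_
  rw [Real.norm_eq_abs, Real.norm_eq_abs, ← mul_pow]
  exact pow_le_pow_left₀ (by positivity) (hh μ) 2

theorem abs_inv_sub_inv_le {s t H : ℝ} (hs : 0 < s) (hst : s / 2 ≤ t)
    (hH : |t ^ 2 - s ^ 2| ≤ H) : |t⁻¹ - s⁻¹| ≤ 2 * H * (s ^ 3)⁻¹ := by
  have ht : 0 < t := by linarith
  have heq : t⁻¹ - s⁻¹ = -(t ^ 2 - s ^ 2) / (t * s * (t + s)) := by
    field_simp
    ring
  have hden : s ^ 3 / 2 ≤ t * s * (t + s) := by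
    calc s ^ 3 / 2 = s / 2 * s * (0 + s) := by ring
      _ ≤ t * s * (t + s) := by gcongr
  rw [heq, abs_div, abs_neg, abs_of_pos (by positivity : 0 < t * s * (t + s))]
  calc |t ^ 2 - s ^ 2| / (t * s * (t + s)) ≤ H / (s ^ 3 / 2) := by
        have : 0 ≤ H := (abs_nonneg _).trans hH
        gcongr
    _ = 2 * H * (s ^ 3)⁻¹ := by
        field_simp

/-- Let φ̂ : ℝ³ → ℝ be C¹ with sup-norm bounds A on φ̂ and B on ∇φ̂. There is a
constant C > 0, depending only on A and B (in particular independent of m), such that for every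
m > 0, every k ∈ ℝ³ with all components nonzero and every h ∈ ℝ³ with 2|h_μ| ≤ |k_μ| for
μ = 1,2,3, one has
|φ̂(k+h)/√(ω_m(k+h)) − φ̂(k)/√(ω_m(k))| ≤ C·|h|·(ω_m(k)^{−1/2} + ω_m(k)^{−3/2}). -/
theorem formFactor_increment_bound (A B : ℝ) :
    ∃ C > (0 : ℝ), ∀ phi : R3 → ℝ, ContDiff ℝ 1 phi →
      (∀ k : R3, |phi k| ≤ A) → (∀ k : R3, ‖fderiv ℝ phi k‖ ≤ B) →
      ∀ m : ℝ, 0 < m → ∀ k : R3, (∀ μ : Fin 3, k μ ≠ 0) →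
        ∀ h : R3, (∀ μ : Fin 3, 2 * |h μ| ≤ |k μ|) →
          |phi (k + h) / Real.sqrt (disp m (k + h)) - phi k / Real.sqrt (disp m k)| ≤
            C * ‖h‖ * (disp m k ^ (-(1 / 2) : ℝ) + disp m k ^ (-(3 / 2) : ℝ)) := by
  refine ⟨2 * |A| + |B| + 1, by positivity, ?_⟩
  intro phi hphi hA hB m hm k _ h hh
  have ha := disp_pos hm k
  have hlip := abs_disp_add_sub_le hm k h
  have hhalf : disp m k / 2 ≤ disp m (k + h) := by
    linarith [(abs_le.mp hlip).1, two_mul_norm_le_of_coord hh, norm_le_disp m k]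
  have hincr : |phi (k + h) - phi k| ≤ B * ‖h‖ := by
    simpa using convex_univ.norm_image_sub_le_of_norm_fderiv_le (𝕜 := ℝ)
      (fun x _ => hphi.differentiable one_ne_zero x) (fun x _ => hB x)
      (Set.mem_univ k) (Set.mem_univ (k + h))
  have hs : 0 < √(disp m k) := Real.sqrt_pos.mpr ha
  have hssq : √(disp m k) ^ 2 = disp m k := Real.sq_sqrt ha.le
  have htsq : √(disp m (k + h)) ^ 2 = disp m (k + h) := Real.sq_sqrt (disp_pos hm _).le
  have hpow₁ : disp m k ^ (-(1 / 2) : ℝ) = (√(disp m k))⁻¹ := by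
    rw [Real.rpow_neg ha.le, Real.sqrt_eq_rpow]
  have hpow₃ : disp m k ^ (-(3 / 2) : ℝ) = (√(disp m k) ^ 3)⁻¹ := by
    rw [Real.rpow_neg ha.le, Real.sqrt_eq_rpow, ← Real.rpow_natCast, ← Real.rpow_mul ha.le]
    norm_num
  rw [hpow₁, hpow₃]
  set s := √(disp m k)
  set t := √(disp m (k + h))
  have hst : s / 2 ≤ t := by
    refine (abs_le_of_sq_le_sq' ?_ (Real.sqrt_nonneg _)).2
    rw [div_pow, hssq, htsq]
    linarith
  have hinv : |t⁻¹ - s⁻¹| ≤ 2 * ‖h‖ * (s ^ 3)⁻¹ :=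
    abs_inv_sub_inv_le hs hst (by rwa [hssq, htsq])
  have hsplit : phi (k + h) / t - phi k / s =
      (phi (k + h) - phi k) * s⁻¹ + phi (k + h) * (t⁻¹ - s⁻¹) := by ring
  calc |phi (k + h) / t - phi k / s|
      ≤ |phi (k + h) - phi k| * s⁻¹ + |phi (k + h)| * |t⁻¹ - s⁻¹| := by
        rw [hsplit]
        refine (abs_add_le _ _).trans_eq ?_
        rw [abs_mul, abs_mul, abs_of_pos (inv_pos.mpr hs)]
    _ ≤ |B| * ‖h‖ * s⁻¹ + |A| * (2 * ‖h‖ * (s ^ 3)⁻¹) := by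
        have hphiA : |phi (k + h)| ≤ |A| := (hA _).trans (le_abs_self A)
        have hincrB : |phi (k + h) - phi k| ≤ |B| * ‖h‖ :=
          hincr.trans (by gcongr; exact le_abs_self B)
        exact add_le_add (mul_le_mul_of_nonneg_right hincrB (inv_pos.mpr hs).le)
          (mul_le_mul hphiA hinv (abs_nonneg _) (abs_nonneg _))
    _ = |B| * (‖h‖ * s⁻¹) + 2 * |A| * (‖h‖ * (s ^ 3)⁻¹) := by ring
    _ ≤ (2 * |A| + |B| + 1) * (‖h‖ * s⁻¹) + (2 * |A| + |B| + 1) * (‖h‖ * (s ^ 3)⁻¹) := by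
        gcongr <;> linarith [abs_nonneg A, abs_nonneg B]
    _ = (2 * |A| + |B| + 1) * ‖h‖ * (s⁻¹ + (s ^ 3)⁻¹) := by ring
end
end

section
/- Let φ̂ : ℝ³ → ℝ be twice continuously differentiable with φ̂, all its first partial derivatives and all its second partial derivatives bounded. Then there is a constant C > 0, depending only on the sup-norms of φ̂ and of its partial derivatives up to order two (in particular independent of m), such that for every m > 0, every k ∈ ℝ³ and every μ ∈ {1,2,3}, the function k ↦ φ̂(k)/√(ω_m(k)) is twice partially differentiable in the μ-th direction and | ∂_μ∂_μ ( φ̂/√(ω_m) )(k) | ≤ C·( ω_m(k)^{−1/2} + ω_m(k)^{−3/2} + ω_m(k)^{−5/2} ). -/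
noncomputable section

theorem HasLineDerivAt.mul {E : Type*} [AddCommGroup E] [Module ℝ E] {f g : E → ℝ}
    {f' g' : ℝ} {x v : E} (hf : HasLineDerivAt ℝ f f' x v) (hg : HasLineDerivAt ℝ g g' x v) :
    HasLineDerivAt ℝ (fun y => f y * g y) (f' * g x + f x * g') x v := by
  simpa [HasLineDerivAt] using HasDerivAt.fun_mul hf hg

theorem abs_coord_le_disp (m : ℝ) (k : R3) (μ : Fin 3) : |k μ| ≤ disp m k :=
  (PiLp.norm_apply_le k μ).trans (Real.le_sqrt_of_sq_le (by nlinarith [sq_nonneg m]))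

theorem hasLineDerivAt_coord (k : R3) (μ : Fin 3) :
    HasLineDerivAt ℝ (fun y : R3 => y μ) 1 k (EuclideanSpace.single μ 1) := by
  simpa [HasLineDerivAt] using (hasDerivAt_id (0 : ℝ)).const_add (k μ)

theorem hasLineDerivAt_disp_rpow {m : ℝ} (hm : 0 < m) (p : ℝ) (k : R3) (μ : Fin 3) :
    HasLineDerivAt ℝ (fun y => disp m y ^ p) (p * (k μ * disp m k ^ (p - 2))) k
      (EuclideanSpace.single μ 1) := by
  have hw := disp_pos hm k
  have hs : HasFDerivAt (fun y : R3 => ‖y‖ ^ 2 + m ^ 2) (2 • innerSL ℝ k) k :=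
    ((hasStrictFDerivAt_norm_sq k).hasFDerivAt).add_const _
  have h := (((hs.sqrt (by positivity)).rpow_const (p := p) (Or.inl hw.ne')).hasLineDerivAt
    (EuclideanSpace.single μ 1))
  refine h.congr_deriv ?_
  have he : disp m k ^ (p - 1) = disp m k ^ (p - 2) * disp m k := by
    rw [← Real.rpow_add_one hw.ne']; congr 1; ring
  change (p * disp m k ^ (p - 1)) • ((1 / (2 * disp m k)) • (2 • innerSL ℝ k))
    (EuclideanSpace.single μ 1) = _
  rw [he]
  simp [EuclideanSpace.inner_single_right]
  field_simp

theorem inv_sqrt_disp (m : ℝ) (k : R3) :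
    (Real.sqrt (disp m k))⁻¹ = disp m k ^ (-(1 / 2) : ℝ) := by
  rw [Real.sqrt_eq_rpow, Real.rpow_neg (x := disp m k) (Real.sqrt_nonneg _)]

theorem hasLineDerivAt_formFactor {phi : R3 → ℝ} (hphi : Differentiable ℝ phi) {m : ℝ}
    (hm : 0 < m) (k : R3) (μ : Fin 3) :
    HasLineDerivAt ℝ (fun y => phi y / Real.sqrt (disp m y))
      (fderiv ℝ phi k (EuclideanSpace.single μ 1) * disp m k ^ (-(1 / 2) : ℝ) +
        phi k * (-(1 / 2) * (k μ * disp m k ^ (-(5 / 2) : ℝ)))) k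
      (EuclideanSpace.single μ 1) := by
  simp only [div_eq_mul_inv _ (Real.sqrt _), inv_sqrt_disp]
  rw [show (-(5 / 2) : ℝ) = -(1 / 2) - 2 by norm_num]
  exact ((hphi k).hasFDerivAt.hasLineDerivAt (EuclideanSpace.single μ 1)).mul
    (hasLineDerivAt_disp_rpow hm (-(1 / 2)) k μ)

theorem hasLineDerivAt_lineDeriv_formFactor {phi : R3 → ℝ} (hphi : ContDiff ℝ 2 phi) {m : ℝ}
    (hm : 0 < m) (k : R3) (μ : Fin 3) :
    HasLineDerivAt ℝ
      (fun y => lineDeriv ℝ (fun z => phi z / Real.sqrt (disp m z)) y (EuclideanSpace.single μ 1))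
      (fderiv ℝ (fderiv ℝ phi) k (EuclideanSpace.single μ 1) (EuclideanSpace.single μ 1) *
          disp m k ^ (-(1 / 2) : ℝ) -
        fderiv ℝ phi k (EuclideanSpace.single μ 1) * (k μ * disp m k ^ (-(5 / 2) : ℝ)) +
        phi k * (-(1 / 2) * disp m k ^ (-(5 / 2) : ℝ) +
          5 / 4 * (k μ ^ 2 * disp m k ^ (-(9 / 2) : ℝ)))) k
      (EuclideanSpace.single μ 1) := by
  have hd : Differentiable ℝ phi := hphi.differentiable (by norm_num)
  have hd' : Differentiable ℝ (fderiv ℝ phi) :=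
    (hphi.fderiv_right (m := 1) (by norm_num)).differentiable (by norm_num)
  simp only [fun y => (hasLineDerivAt_formFactor hd hm y μ).lineDeriv]
  have h₁ := ((hd' k).hasFDerivAt.clm_apply
    (hasFDerivAt_const (EuclideanSpace.single μ (1 : ℝ)) k)).hasLineDerivAt
      (EuclideanSpace.single μ 1)
  have h₀ := (hd k).hasFDerivAt.hasLineDerivAt (EuclideanSpace.single μ 1)
  have hconst : HasLineDerivAt ℝ (fun _ : R3 => (-(1 / 2) : ℝ)) 0 k (EuclideanSpace.single μ 1) :=
    hasDerivAt_const _ _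
  have h := HasDerivAt.add (h₁.mul (hasLineDerivAt_disp_rpow hm (-(1 / 2)) k μ))
    (h₀.mul (hconst.mul ((hasLineDerivAt_coord k μ).mul
      (hasLineDerivAt_disp_rpow hm (-(5 / 2)) k μ))))
  refine HasDerivAt.congr_deriv h ?_
  have e₁ : (-(1 / 2) - 2 : ℝ) = -(5 / 2) := by norm_num
  have e₂ : (-(5 / 2) - 2 : ℝ) = -(9 / 2) := by norm_num
  simp only [e₁, e₂]
  simp
  ring

theorem abs_coord_pow_mul_disp_rpow_le {m : ℝ} (hm : 0 < m) (k : R3) (μ : Fin 3) (n : ℕ) (p : ℝ) :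
    |k μ ^ n * disp m k ^ p| ≤ disp m k ^ (n + p) := by
  have hw := disp_pos hm k
  rw [abs_mul, abs_pow, abs_of_pos (Real.rpow_pos_of_pos hw p), Real.rpow_add hw,
    Real.rpow_natCast]
  gcongr
  exact abs_coord_le_disp m k μ

/-- Let φ̂ : ℝ³ → ℝ be C² with sup-norm bounds A on φ̂, B on its first partial
derivatives and D on its second partial derivatives. There is a constant C > 0, depending only
on A, B and D (in particular independent of m), such that for every m > 0, every k ∈ ℝ³ and
every μ ∈ {1,2,3}, the function k ↦ φ̂(k)/√(ω_m(k)) is twice partially differentiable in the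
μ-th direction and |∂_μ∂_μ(φ̂/√ω_m)(k)| ≤ C·(ω_m(k)^{−1/2} + ω_m(k)^{−3/2} + ω_m(k)^{−5/2}). -/
theorem formFactor_second_deriv_bound (A B D : ℝ) :
    ∃ C > (0 : ℝ), ∀ phi : R3 → ℝ, ContDiff ℝ 2 phi →
      (∀ k : R3, |phi k| ≤ A) →
      (∀ k : R3, ‖iteratedFDeriv ℝ 1 phi k‖ ≤ B) →
      (∀ k : R3, ‖iteratedFDeriv ℝ 2 phi k‖ ≤ D) →
      ∀ m : ℝ, 0 < m → ∀ k : R3, ∀ μ : Fin 3,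
        LineDifferentiableAt ℝ (fun y => phi y / Real.sqrt (disp m y)) k
          (EuclideanSpace.single μ (1 : ℝ)) ∧
        LineDifferentiableAt ℝ
          (fun y => lineDeriv ℝ (fun z => phi z / Real.sqrt (disp m z)) y
            (EuclideanSpace.single μ (1 : ℝ))) k (EuclideanSpace.single μ (1 : ℝ)) ∧
        |lineDeriv ℝ
            (fun y => lineDeriv ℝ (fun z => phi z / Real.sqrt (disp m z)) y
              (EuclideanSpace.single μ (1 : ℝ))) k (EuclideanSpace.single μ (1 : ℝ))| ≤
          C * (disp m k ^ (-(1 / 2) : ℝ) + disp m k ^ (-(3 / 2) : ℝ) +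
            disp m k ^ (-(5 / 2) : ℝ)) := by
  refine ⟨2 * |A| + |B| + |D| + 1, by positivity, ?_⟩
  intro phi hphi hA hB hD m hm k μ
  have hd : Differentiable ℝ phi := hphi.differentiable (by norm_num)
  have h := hasLineDerivAt_lineDeriv_formFactor hphi hm k μ
  refine ⟨(hasLineDerivAt_formFactor hd hm k μ).lineDifferentiableAt, h.lineDifferentiableAt, ?_⟩
  rw [h.lineDeriv]
  have h₀ : |phi k| ≤ |A| := (hA k).trans (le_abs_self A)
  have h₁ : |fderiv ℝ phi k (EuclideanSpace.single μ 1)| ≤ |B| := by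
    have := (iteratedFDeriv ℝ 1 phi k).le_opNorm ![EuclideanSpace.single μ 1]
    simp at this
    exact this.trans ((by simpa using hB k : _ ≤ B).trans (le_abs_self B))
  have h₂ : |fderiv ℝ (fderiv ℝ phi) k (EuclideanSpace.single μ 1) (EuclideanSpace.single μ 1)|
      ≤ |D| := by
    have := (iteratedFDeriv ℝ 2 phi k).le_opNorm
      ![EuclideanSpace.single μ 1, EuclideanSpace.single μ 1]
    simp [iteratedFDeriv_two_apply, Fin.prod_univ_two] at this
    exact this.trans ((hD k).trans (le_abs_self D))
  have hw := disp_pos hm k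
  have hk₁ : |k μ * disp m k ^ (-(5 / 2) : ℝ)| ≤ disp m k ^ (-(3 / 2) : ℝ) := by
    convert abs_coord_pow_mul_disp_rpow_le hm k μ 1 (-(5 / 2)) using 2 <;> norm_num
  have hk₂ : |k μ ^ 2 * disp m k ^ (-(9 / 2) : ℝ)| ≤ disp m k ^ (-(5 / 2) : ℝ) := by
    convert abs_coord_pow_mul_disp_rpow_le hm k μ 2 (-(9 / 2)) using 2; norm_num
  have p₁ := Real.rpow_pos_of_pos hw (-(1 / 2))
  have p₃ := Real.rpow_pos_of_pos hw (-(3 / 2))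
  have p₅ := Real.rpow_pos_of_pos hw (-(5 / 2))
  have hk₃ : |-(1 / 2) * disp m k ^ (-(5 / 2) : ℝ) +
      5 / 4 * (k μ ^ 2 * disp m k ^ (-(9 / 2) : ℝ))| ≤ 2 * disp m k ^ (-(5 / 2) : ℝ) := by
    rw [abs_le] at hk₂ ⊢
    constructor <;> linarith
  have t₁ : |fderiv ℝ (fderiv ℝ phi) k (EuclideanSpace.single μ 1) (EuclideanSpace.single μ 1) *
      disp m k ^ (-(1 / 2) : ℝ)| ≤ |D| * disp m k ^ (-(1 / 2) : ℝ) := by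
    rw [abs_mul, abs_of_pos p₁]
    gcongr
  have t₂ := (abs_mul _ _).trans_le (mul_le_mul h₁ hk₁ (abs_nonneg _) (abs_nonneg _))
  have t₃ := (abs_mul _ _).trans_le (mul_le_mul h₀ hk₃ (abs_nonneg _) (abs_nonneg _))
  refine (abs_add_le _ _).trans ((add_le_add ((abs_sub _ _).trans (add_le_add t₁ t₂)) t₃).trans ?_)
  have := abs_nonneg A
  have := abs_nonneg B
  have := abs_nonneg D
  refine sub_nonneg.1 (le_of_le_of_eq (b := (2 * |A| + |B| + 1) * disp m k ^ (-(1 / 2) : ℝ) +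
    (2 * |A| + |D| + 1) * disp m k ^ (-(3 / 2) : ℝ) +
    (|B| + |D| + 1) * disp m k ^ (-(5 / 2) : ℝ)) (by positivity) (by ring))
end
end
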